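/- arXiv:2405.19602 — 2 statements merged into one kernel-verified Lean document; each statement's English description precedes it below -/
import Mathlib

section
/- Let q : ℝ² → ℂ be smooth, set σ₃ = diag(1,−1), Q = [[0, conj(q)],[q, 0]], U(λ) = i(λσ₃ + Q) and V(λ) = i(2λ²σ₃ + 2λQ − σ₃(Q² + i∂ₓQ)). Let λ₁,…,λ_N ∈ ℂ satisfy conj(λᵢ) ≠ λⱼ for all i, j, and let φᵢ : ℝ² → ℂ² be smooth solutions of ∂ₓφᵢ = U(λᵢ)φᵢ and ∂ₜφᵢ = V(λᵢ)φᵢ. Put Y_N = (φ₁,…,φ_N) (a 2×N matrix), M = (φᵢ† φⱼ/(conj(λᵢ) − λⱼ))₁≤i,j≤N, and assume M(x,t) is invertible for all (x,t) ∈ ℝ². Define q^[N] = q + 2 Y_{N,2} M⁻¹ Y_{N,1}†, where Y_{N,r} denotes the r-th row of Y_N, and for λ ∈ ℂ \ {conj(λ₁),…,conj(λ_N)} set D(λ) = diag(λ−conj(λ₁),…,λ−conj(λ_N)) and T_N(λ) = I₂ + Y_N M⁻¹ D(λ)⁻¹ Y_N†. Then for every such λ and every smooth Φ : ℝ² → ℂ^{2×2}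 satisfying ∂ₓΦ = U(λ)Φ and ∂ₜΦ = V(λ)Φ, the function Φ^[N] = T_N(λ)Φ satisfies ∂ₓΦ^[N] = U^[N](λ)Φ^[N] and ∂ₜΦ^[N] = V^[N](λ)Φ^[N], where U^[N], V^[N] are U, V with q replaced by q^[N]. -/
open Complex Matrix

noncomputable section

/-- Partial derivative in `x` of a function on `ℝ² = ℝ × ℝ` (coordinates `(x,t)`). -/
def pdx (f : ℝ × ℝ → ℂ) (p : ℝ × ℝ) : ℂ := fderiv ℝ f p (1, 0)

/-- Partial derivative in `t` of a function on `ℝ² = ℝ × ℝ` (coordinates `(x,t)`). -/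
def pdt (f : ℝ × ℝ → ℂ) (p : ℝ × ℝ) : ℂ := fderiv ℝ f p (0, 1)

/-- The Pauli matrix `σ₃ = diag(1, −1)`. -/
def sigma3 : Matrix (Fin 2) (Fin 2) ℂ := !![1, 0; 0, -1]

/-- The potential matrix `Q = [[0, conj q],[q, 0]]`. -/
def Qmat (q : ℝ × ℝ → ℂ) (p : ℝ × ℝ) : Matrix (Fin 2) (Fin 2) ℂ :=
  !![0, (starRingEnd ℂ) (q p); q p, 0]

/-- The entrywise `x`-derivative `∂ₓQ`. -/
def Qmatx (q : ℝ × ℝ → ℂ) (p : ℝ × ℝ) : Matrix (Fin 2) (Fin 2) ℂ :=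
  Matrix.of fun i j => pdx (fun p' => Qmat q p' i j) p

/-- The Lax matrix `U(λ) = i(λσ₃ + Q)`. -/
def Umat (q : ℝ × ℝ → ℂ) (lam : ℂ) (p : ℝ × ℝ) : Matrix (Fin 2) (Fin 2) ℂ :=
  Complex.I • (lam • sigma3 + Qmat q p)

/-- The Lax matrix `V(λ) = i(2λ²σ₃ + 2λQ − σ₃(Q² + i∂ₓQ))`. -/
def Vmat (q : ℝ × ℝ → ℂ) (lam : ℂ) (p : ℝ × ℝ) : Matrix (Fin 2) (Fin 2) ℂ :=
  Complex.I • ((2 * lam ^ 2) • sigma3 + (2 * lam) • Qmat q p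
    - sigma3 * (Qmat q p * Qmat q p + Complex.I • Qmatx q p))

end

/-- Entrywise differentiability of a matrix function at `p`, with given derivative in direction `v`. -/
def HD {m n : Type} (v p : ℝ × ℝ) (A : ℝ × ℝ → Matrix m n ℂ) (A' : Matrix m n ℂ) : Prop :=
  ∀ i j, DifferentiableAt ℝ (fun p' => A p' i j) p ∧ fderiv ℝ (fun p' => A p' i j) p v = A' i j

theorem HD.unique {m n : Type} {v p : ℝ × ℝ} {A : ℝ × ℝ → Matrix m n ℂ} {A' A'' : Matrix m n ℂ}
    (h : HD v p A A') (h' : HD v p A A'') : A' = A'' := by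
  ext i j
  rw [← (h i j).2, (h' i j).2]

theorem HD.const {m n : Type} {v p : ℝ × ℝ} (C : Matrix m n ℂ) : HD v p (fun _ => C) 0 := by
  intro i j
  simp

theorem HD.add {m n : Type} {v p : ℝ × ℝ} {A B : ℝ × ℝ → Matrix m n ℂ} {A' B' : Matrix m n ℂ}
    (h : HD v p A A') (h' : HD v p B B') : HD v p (fun p => A p + B p) (A' + B') := by
  intro i j
  refine ⟨(h i j).1.add (h' i j).1, ?_⟩
  have := fderiv_fun_add (h i j).1 (h' i j).1
  simp only [Matrix.add_apply]
  rw [this, ← (h i j).2, ← (h' i j).2]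
  rfl

theorem HD.sub {m n : Type} {v p : ℝ × ℝ} {A B : ℝ × ℝ → Matrix m n ℂ} {A' B' : Matrix m n ℂ}
    (h : HD v p A A') (h' : HD v p B B') : HD v p (fun p => A p - B p) (A' - B') := by
  intro i j
  refine ⟨(h i j).1.sub (h' i j).1, ?_⟩
  have := fderiv_fun_sub (h i j).1 (h' i j).1
  simp only [Matrix.sub_apply]
  rw [this, ← (h i j).2, ← (h' i j).2]
  rfl

theorem HD.mul {m n k : Type} [Fintype n] {v p : ℝ × ℝ} {A : ℝ × ℝ → Matrix m n ℂ}
    {B : ℝ × ℝ → Matrix n k ℂ} {A' : Matrix m n ℂ} {B' : Matrix n k ℂ}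
    (h : HD v p A A') (h' : HD v p B B') :
    HD v p (fun p => A p * B p) (A' * B p + A p * B') := by
  intro i j
  have key : HasFDerivAt (fun p' => (A p' * B p') i j)
      (∑ l, (A p i l • fderiv ℝ (fun p' => B p' l j) p
        + B p l j • fderiv ℝ (fun p' => A p' i l) p)) p := by
    simp only [Matrix.mul_apply]
    exact HasFDerivAt.fun_sum fun l _ => (h i l).1.hasFDerivAt.mul (h' l j).1.hasFDerivAt
  refine ⟨key.differentiableAt, ?_⟩
  rw [key.fderiv]
  simp only [_root_.sum_apply, _root_.add_apply,
    _root_.smul_apply, (h _ _).2, (h' _ _).2, Matrix.add_apply, Matrix.mul_apply,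
    smul_eq_mul, ← Finset.sum_add_distrib]
  refine Finset.sum_congr rfl fun l _ => by ring

theorem diff_conj {f : ℝ × ℝ → ℂ} {p v : ℝ × ℝ} (h : DifferentiableAt ℝ f p) :
    DifferentiableAt ℝ (fun p' => (starRingEnd ℂ) (f p')) p ∧
      fderiv ℝ (fun p' => (starRingEnd ℂ) (f p')) p v = (starRingEnd ℂ) (fderiv ℝ f p v) := by
  have := (Complex.conjCLE.toContinuousLinearMap.hasFDerivAt (x := f p)).comp p h.hasFDerivAt
  have h2 : HasFDerivAt (fun p' => (starRingEnd ℂ) (f p'))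
    (Complex.conjCLE.toContinuousLinearMap.comp (fderiv ℝ f p)) p := this
  refine ⟨h2.differentiableAt, ?_⟩
  rw [h2.fderiv]
  simp

theorem HD.conjT {m n : Type} {v p : ℝ × ℝ} {A : ℝ × ℝ → Matrix m n ℂ} {A' : Matrix m n ℂ}
    (h : HD v p A A') : HD v p (fun p => (A p)ᴴ) A'ᴴ := by
  intro i j
  have := diff_conj (v := v) (h j i).1
  rw [(h j i).2] at this
  exact this

theorem diff_det {n : Type} [Fintype n] [DecidableEq n] {p : ℝ × ℝ}
    {A : ℝ × ℝ → Matrix n n ℂ} (h : ∀ i j, DifferentiableAt ℝ (fun p' => A p' i j) p) :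
    DifferentiableAt ℝ (fun p' => (A p').det) p := by
  simp only [Matrix.det_apply']
  refine DifferentiableAt.fun_sum fun σ _ => ?_
  refine (differentiableAt_const _).mul ?_
  exact (HasFDerivAt.finsetProd (u := Finset.univ) (g := fun i p' => A p' (σ i) i)
    fun i _ => (h (σ i) i).hasFDerivAt).differentiableAt

theorem HD.inv {n : Type} [Fintype n] [DecidableEq n] {v p : ℝ × ℝ}
    {A : ℝ × ℝ → Matrix n n ℂ} {A' : Matrix n n ℂ}
    (h : HD v p A A') (hA : ∀ p, IsUnit (A p)) :
    HD v p (fun p => (A p)⁻¹) (-((A p)⁻¹ * A' * (A p)⁻¹)) := by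
  have hdet : ∀ p, IsUnit (A p).det := fun p => (Matrix.isUnit_iff_isUnit_det _).1 (hA p)
  have hd : ∀ i j, DifferentiableAt ℝ (fun p' => (A p')⁻¹ i j) p := by
    intro i j
    have e : (fun p' => (A p')⁻¹ i j) = fun p' => ((A p').det)⁻¹ * (A p').adjugate i j := by
      funext p'
      rw [Matrix.inv_def, Matrix.smul_apply, Ring.inverse_eq_inv', smul_eq_mul]
    rw [e]
    refine DifferentiableAt.mul ((diff_det fun i j => (h i j).1).inv (hdet p).ne_zero) ?_
    simp only [Matrix.adjugate_apply]
    refine diff_det fun a b => ?_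
    by_cases hab : a = j
    · subst hab
      simp
    · simp only [Matrix.updateRow_ne hab]
      exact (h a b).1
  have h1 : HD v p (fun p => (A p)⁻¹) (Matrix.of fun i j => fderiv ℝ (fun p' => (A p')⁻¹ i j) p v) :=
    fun i j => ⟨hd i j, rfl⟩
  generalize Matrix.of (fun i j => fderiv ℝ (fun p' => (A p')⁻¹ i j) p v) = B at h1
  have h2 := h.mul h1
  have h3 : (fun p => A p * (A p)⁻¹) = fun _ => 1 := by
    funext p
    exact Matrix.mul_nonsing_inv _ (hdet p)
  rw [h3] at h2
  have h4 := h2.unique (HD.const 1)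
  have h5 : B = -((A p)⁻¹ * A' * (A p)⁻¹) := by
    have : (A p)⁻¹ * (A' * (A p)⁻¹ + A p * B) = 0 := by rw [h4, Matrix.mul_zero]
    rw [Matrix.mul_add, Matrix.nonsing_inv_mul_cancel_left _ _ (hdet p), ← Matrix.mul_assoc] at this
    exact (neg_eq_of_add_eq_zero_right this).symm
  rw [← h5]
  exact h1

/-- Purely algebraic `x`-step. -/
theorem alg_x {n : Type} [Fintype n] [DecidableEq n] (Y Yx : Matrix (Fin 2) n ℂ)
    (K L Ls R Mx : Matrix n n ℂ) (Z Zx : Matrix n (Fin 2) ℂ) (s Q : Matrix (Fin 2) (Fin 2) ℂ)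
    (hYx : Yx = I • (s * Y * L + Q * Y)) (hZx : Zx = -(I • (Ls * Z * s + Z * Q)))
    (hMx : Mx = -(I • (Z * s * Y)))
    (hLK : L * K = K * Ls - K * Z * Y * K) (hR : R * Ls = Ls * R) :
    Yx * K * R * Z + Y * (-(K * Mx * K)) * R * Z + Y * K * R * Zx
    = I • (s * (Y * K * (R * Ls) * Z) - s * (Y * K * Z) * (Y * K * R * Z) + Q * (Y * K * R * Z)
      + (Y * K * Z) * s * (Y * K * R * Z) - (Y * K * (R * Ls) * Z) * s - (Y * K * R * Z) * Q) := by
  have hLK' : ∀ B : Matrix n (Fin 2) ℂ, L * (K * B) = K * (Ls * B) - K * (Z * (Y * (K * B))) := by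
    intro B
    rw [← Matrix.mul_assoc, hLK]
    simp only [Matrix.sub_mul, Matrix.mul_assoc]
  have hR' : ∀ B : Matrix n (Fin 2) ℂ, R * (Ls * B) = Ls * (R * B) := by
    intro B
    rw [← Matrix.mul_assoc, hR, Matrix.mul_assoc]
  subst hYx hZx hMx
  simp only [Matrix.mul_add, Matrix.add_mul, Matrix.mul_sub, Matrix.sub_mul, Matrix.mul_neg,
    Matrix.neg_mul, Matrix.smul_mul, Matrix.mul_smul, Matrix.mul_assoc, hLK', hR', smul_add,
    smul_sub, smul_neg, neg_neg, neg_add]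
  abel

/-- Purely algebraic `t`-step. -/
theorem alg_t {n : Type} [Fintype n] [DecidableEq n] (Y Yt : Matrix (Fin 2) n ℂ)
    (K L Ls R Mt : Matrix n n ℂ) (Z Zt : Matrix n (Fin 2) ℂ) (s Q W : Matrix (Fin 2) (Fin 2) ℂ)
    (hYt : Yt = (2 * I) • (s * Y * L * L + Q * Y * L) + W * Y)
    (hZt : Zt = -((2 * I) • (Ls * Ls * Z * s + Ls * Z * Q)) - Z * W)
    (hMt : Mt = -((2 * I) • (Ls * Z * s * Y + Z * s * Y * L + Z * Q * Y)))
    (hLK : L * K = K * Ls - K * Z * Y * K) (hR : R * Ls = Ls * R)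
    (S S1 P P1 P2 : Matrix (Fin 2) (Fin 2) ℂ)
    (hS : S = Y * K * Z) (hS1 : S1 = Y * K * Ls * Z) (hP : P = Y * K * R * Z)
    (hP1 : P1 = Y * K * (R * Ls) * Z) (hP2 : P2 = Y * K * (R * Ls * Ls) * Z) :
    Yt * K * R * Z + Y * (-(K * Mt * K)) * R * Z + Y * K * R * Zt
    = (2 * I) • (s * (P2 - S * P1 - S1 * P + S * S * P) + Q * (P1 - S * P)
      + S1 * s * P + S * s * (P1 - S * P) + S * Q * P - P2 * s - P1 * Q) + W * P - P * W := by
  have hLK' : ∀ B : Matrix n (Fin 2) ℂ, L * (K * B) = K * (Ls * B) - K * (Z * (Y * (K * B))) := by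
    intro B
    rw [← Matrix.mul_assoc, hLK]
    simp only [Matrix.sub_mul, Matrix.mul_assoc]
  have hR' : ∀ B : Matrix n (Fin 2) ℂ, R * (Ls * B) = Ls * (R * B) := by
    intro B
    rw [← Matrix.mul_assoc, hR, Matrix.mul_assoc]
  subst hYt hZt hMt hS hS1 hP hP1 hP2
  simp only [Matrix.mul_add, Matrix.add_mul, Matrix.mul_sub, Matrix.sub_mul, Matrix.mul_neg,
    Matrix.neg_mul, Matrix.smul_mul, Matrix.mul_smul, Matrix.mul_assoc, hLK', hR', smul_add,
    smul_sub, smul_neg, neg_neg, neg_add, neg_sub]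
  abel

theorem ex_entries (S : Matrix (Fin 2) (Fin 2) ℂ) : ∃ a b c d, S = !![a, b; c, d] :=
  ⟨_, _, _, _, Matrix.eta_fin_two S⟩

theorem fin_x (a b l : ℂ) (S P : Matrix (Fin 2) (Fin 2) ℂ) :
    I • (sigma3 * (l • P - S) - sigma3 * S * P + !![0, a; b, 0] * P
      + S * sigma3 * P - (l • P - S) * sigma3 - P * !![0, a; b, 0])
    = I • (l • sigma3 + (!![0, a; b, 0] + (S * sigma3 - sigma3 * S))) * (1 + P)
      - (1 + P) * I • (l • sigma3 + !![0, a; b, 0]) := by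
  have h1 : (1 : Matrix (Fin 2) (Fin 2) ℂ) = !![1, 0; 0, 1] := Matrix.one_fin_two
  obtain ⟨s1, s2, s3, s4, rfl⟩ := ex_entries S
  obtain ⟨p1, p2, p3, p4, rfl⟩ := ex_entries P
  rw [h1]
  ext i j
  fin_cases i <;> fin_cases j <;>
    simp [sigma3] <;> ring

theorem fin_t (a b c d l : ℂ) (s Q Qx S S1 P P1 P2 W Q1 Sx : Matrix (Fin 2) (Fin 2) ℂ)
    (hs : s = sigma3) (hQ : Q = !![0, a; b, 0]) (hQx : Qx = !![0, c; d, 0])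
    (hP1 : P1 = l • P - S) (hP2 : P2 = l • P1 - S1)
    (hW : W = -(I • (s * (Q * Q + I • Qx))))
    (hQ1 : Q1 = Q + (S * s - s * S))
    (hSx : Sx = I • (s * S1 - s * S * S + Q * S + S * s * S - S1 * s - S * Q)) :
    (2 * I) • (s * (P2 - S * P1 - S1 * P + S * S * P) + Q * (P1 - S * P)
      + S1 * s * P + S * s * (P1 - S * P) + S * Q * P - P2 * s - P1 * Q) + W * P - P * W
    = I • ((2 * l ^ 2) • s + (2 * l) • Q1 - s * (Q1 * Q1 + I • (Qx + (Sx * s - s * Sx)))) * (1 + P)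
      - (1 + P) * I • ((2 * l ^ 2) • s + (2 * l) • Q - s * (Q * Q + I • Qx)) := by
  have hI : I ^ 2 = -1 := Complex.I_sq
  have hI3 : I ^ 3 = -I := by rw [pow_succ, hI]; ring
  have h1 : (1 : Matrix (Fin 2) (Fin 2) ℂ) = !![1, 0; 0, 1] := Matrix.one_fin_two
  rw [h1]
  obtain ⟨s1, s2, s3, s4, rfl⟩ := ex_entries S
  obtain ⟨p1, p2, p3, p4, rfl⟩ := ex_entries P
  obtain ⟨r1, r2, r3, r4, rfl⟩ := ex_entries S1
  subst hs hQ hQx hP2 hP1 hW hQ1 hSx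
  ext i j
  fin_cases i <;> fin_cases j <;>
    simp [sigma3] <;> ring_nf <;>
    simp only [hI, hI3] <;> ring

/-- **The `N`-fold Darboux transformation of the NLS Lax pair (Theorem 2.1).**
If the `φᵢ` are smooth vector solutions of the Lax pair at `λᵢ` (with
`conj(λᵢ) ≠ λⱼ` for all `i, j`), `M = (φᵢ†φⱼ/(conj(λᵢ) − λⱼ))` is everywhere invertible,
`q^{[N]} = q + 2·Y_{N,2}M⁻¹Y_{N,1}†`, and
`T_N(λ) = I₂ + Y_N M⁻¹ D(λ)⁻¹ Y_N†` with `D(λ) = diag(λ − conj(λⱼ))`, then for every `λ`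
distinct from all `conj(λⱼ)` and every smooth matrix solution `Φ` of the Lax pair at `λ`,
the function `Φ^{[N]} = T_N(λ)Φ` solves the Lax pair with potential `q^{[N]}`. -/
theorem darboux_transformation
    (q : ℝ × ℝ → ℂ) (hq : ContDiff ℝ (⊤ : ℕ∞) q)
    (N : ℕ) (lam : Fin N → ℂ)
    (hlam : ∀ i j : Fin N, (starRingEnd ℂ) (lam i) ≠ lam j)
    (φ : Fin N → ℝ × ℝ → Fin 2 → ℂ)
    (hφsmooth : ∀ (i : Fin N) (k : Fin 2), ContDiff ℝ (⊤ : ℕ∞) fun p => φ i p k)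
    (hφx : ∀ (i : Fin N) (p : ℝ × ℝ) (k : Fin 2),
      pdx (fun p' => φ i p' k) p = (Umat q (lam i) p).mulVec (φ i p) k)
    (hφt : ∀ (i : Fin N) (p : ℝ × ℝ) (k : Fin 2),
      pdt (fun p' => φ i p' k) p = (Vmat q (lam i) p).mulVec (φ i p) k)
    (M : ℝ × ℝ → Matrix (Fin N) (Fin N) ℂ)
    (hM : ∀ p, M p = Matrix.of fun i j =>
      (∑ k : Fin 2, (starRingEnd ℂ) (φ i p k) * φ j p k)
        / ((starRingEnd ℂ) (lam i) - lam j))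
    (hMinv : ∀ p, IsUnit (M p))
    (qN : ℝ × ℝ → ℂ)
    (hqN : ∀ p, qN p = q p
      + 2 * ∑ i : Fin N, ∑ j : Fin N, φ i p 1 * (M p)⁻¹ i j * (starRingEnd ℂ) (φ j p 0))
    (lam' : ℂ) (hlam' : ∀ j : Fin N, lam' ≠ (starRingEnd ℂ) (lam j))
    (T : ℝ × ℝ → Matrix (Fin 2) (Fin 2) ℂ)
    (hT : ∀ p, T p = 1 + Matrix.of fun k l =>
      ∑ i : Fin N, ∑ j : Fin N,
        φ i p k * (M p)⁻¹ i j * (lam' - (starRingEnd ℂ) (lam j))⁻¹ * (starRingEnd ℂ) (φ j p l))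
    (Φ : ℝ × ℝ → Matrix (Fin 2) (Fin 2) ℂ)
    (hΦsmooth : ∀ k l : Fin 2, ContDiff ℝ (⊤ : ℕ∞) fun p => Φ p k l)
    (hΦx : ∀ (p : ℝ × ℝ) (k l : Fin 2),
      pdx (fun p' => Φ p' k l) p = (Umat q lam' p * Φ p) k l)
    (hΦt : ∀ (p : ℝ × ℝ) (k l : Fin 2),
      pdt (fun p' => Φ p' k l) p = (Vmat q lam' p * Φ p) k l) :
    (∀ (p : ℝ × ℝ) (k l : Fin 2),
      pdx (fun p' => (T p' * Φ p') k l) p = (Umat qN lam' p * (T p * Φ p)) k l) ∧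
    (∀ (p : ℝ × ℝ) (k l : Fin 2),
      pdt (fun p' => (T p' * Φ p') k l) p = (Vmat qN lam' p * (T p * Φ p)) k l) := by
  classical
  set Y : ℝ × ℝ → Matrix (Fin 2) (Fin N) ℂ := fun p => Matrix.of fun k i => φ i p k with hY
  set L : Matrix (Fin N) (Fin N) ℂ := Matrix.diagonal lam with hL
  set Ls : Matrix (Fin N) (Fin N) ℂ := Matrix.diagonal fun i => (starRingEnd ℂ) (lam i) with hLs
  set R : Matrix (Fin N) (Fin N) ℂ :=
    Matrix.diagonal fun i => (lam' - (starRingEnd ℂ) (lam i))⁻¹ with hRdef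
  have hLH : Lᴴ = Ls := by
    rw [hL, hLs, Matrix.diagonal_conjTranspose]; rfl
  have hR : R * Ls = Ls * R := by
    simp only [hRdef, hLs, Matrix.diagonal_mul_diagonal, mul_comm]
  have hRL : R * Ls = lam' • R - 1 := by
    ext i j
    by_cases hij : i = j
    · subst hij
      have := sub_ne_zero.2 (hlam' i)
      simp [hRdef, hLs]
      field_simp
      ring
    · simp [hRdef, hLs, hij]
  have hsub : ∀ i j, (starRingEnd ℂ) (lam i) - lam j ≠ 0 := fun i j => sub_ne_zero.2 (hlam i j)
  have hMdef : ∀ p i j, M p i j = ((Y p)ᴴ * Y p) i j / ((starRingEnd ℂ) (lam i) - lam j) := by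
    intro p i j
    rw [hM p]
    simp [hY, Matrix.mul_apply]
  have hdet : ∀ p, IsUnit (M p).det := fun p => (Matrix.isUnit_iff_isUnit_det _).1 (hMinv p)
  have hSyl : ∀ p, Ls * M p - M p * L = (Y p)ᴴ * Y p := by
    intro p
    ext i j
    rw [Matrix.sub_apply, hLs, hL, Matrix.diagonal_mul, Matrix.mul_diagonal, hMdef]
    rw [mul_comm, ← mul_sub, div_mul_cancel₀ _ (hsub i j)]
  have hMH : ∀ p, (M p)ᴴ = - M p := by
    intro p
    ext i j
    rw [Matrix.conjTranspose_apply, Matrix.neg_apply, hMdef, hMdef]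
    have h1 : star (((Y p)ᴴ * Y p) j i) = ((Y p)ᴴ * Y p) i j := by
      have h0 : ((Y p)ᴴ * Y p)ᴴ = (Y p)ᴴ * Y p := by
        rw [Matrix.conjTranspose_mul, Matrix.conjTranspose_conjTranspose]
      exact congrFun (congrFun h0 i) j
    rw [star_div₀, h1, star_sub, ← div_neg, neg_sub]
    congr 1
    simp
  have hLK : ∀ p, L * (M p)⁻¹ = (M p)⁻¹ * Ls - (M p)⁻¹ * (Y p)ᴴ * Y p * (M p)⁻¹ := by
    intro p
    have : (M p)⁻¹ * (Ls * M p - M p * L) * (M p)⁻¹ = (M p)⁻¹ * Ls - L * (M p)⁻¹ := by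
      rw [Matrix.mul_sub, Matrix.sub_mul, Matrix.nonsing_inv_mul_cancel_left _ _ (hdet p),
        ← Matrix.mul_assoc, Matrix.mul_nonsing_inv_cancel_right _ _ (hdet p)]
    rw [hSyl] at this
    rw [Matrix.mul_assoc _ _ (Y p), this]
    abel
  set S : ℝ × ℝ → Matrix (Fin 2) (Fin 2) ℂ := fun p => Y p * (M p)⁻¹ * (1 : Matrix (Fin N) (Fin N) ℂ) * (Y p)ᴴ with hS
  set P : ℝ × ℝ → Matrix (Fin 2) (Fin 2) ℂ := fun p => Y p * (M p)⁻¹ * R * (Y p)ᴴ with hP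
  have hTP : ∀ p, T p = 1 + P p := by
    intro p
    rw [hT p]
    congr 1
    ext k l
    simp only [hP, hRdef]
    rw [Matrix.mul_apply]
    simp only [Matrix.mul_diagonal]
    simp only [hY, Matrix.mul_apply, Matrix.of_apply,
      Matrix.conjTranspose_apply, Finset.sum_mul]
    rw [Finset.sum_comm]
    rfl
  have hSH : ∀ p, (S p)ᴴ = - S p := by
    intro p
    simp only [hS, Matrix.mul_one, Matrix.conjTranspose_mul, Matrix.conjTranspose_conjTranspose,
      Matrix.conjTranspose_nonsing_inv, hMH]
    have : (-M p)⁻¹ = -(M p)⁻¹ := by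
      apply Matrix.inv_eq_left_inv
      rw [neg_mul_neg, Matrix.nonsing_inv_mul _ (hdet p)]
    rw [this]
    simp [Matrix.mul_assoc]
  have hQN : ∀ p, Qmat qN p = Qmat q p + (S p * sigma3 - sigma3 * S p) := by
    intro p
    have h1 : qN p = q p + 2 * S p 1 0 := by
      rw [hqN p]
      congr 2
      simp only [hS, hY, Matrix.mul_one, Matrix.mul_apply, Matrix.of_apply,
        Matrix.conjTranspose_apply, Finset.sum_mul]
      rw [Finset.sum_comm]
      rfl
    have h2 : (starRingEnd ℂ) (S p 1 0) = - S p 0 1 := by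
      have := congrFun (congrFun (hSH p) 0) 1
      rw [Matrix.conjTranspose_apply] at this
      exact this
    rw [Qmat, h1]
    clear h1
    generalize S p = S0 at h2
    obtain ⟨s1, s2, s3, s4, rfl⟩ := ex_entries S0
    have h3 : (starRingEnd ℂ) s3 = - s2 := by simpa using h2
    have h4 : (starRingEnd ℂ) (2 : ℂ) = 2 := map_ofNat _ 2
    ext i j
    fin_cases i <;> fin_cases j <;>
      simp [Qmat, h3, h4, sigma3] <;> ring
  have hqd : ∀ p, DifferentiableAt ℝ q p := fun p => (hq.differentiable (by simp)) p
  have hQd : ∀ p, HD (1, 0) p (Qmat q) (Qmatx q p) := by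
    intro p i j
    refine ⟨?_, rfl⟩
    fin_cases i <;> fin_cases j <;> simp [Qmat, hqd p]
    exact (diff_conj (v := (1, 0)) (hqd p)).1
  have hQx : ∀ p, Qmatx q p = !![0, (starRingEnd ℂ) (pdx q p); pdx q p, 0] := by
    intro p
    ext i j
    fin_cases i <;> fin_cases j <;> simp [Qmatx, Qmat, pdx]
    exact (diff_conj (v := (1, 0)) (hqd p)).2
  have hYd : ∀ v p, HD v p Y (Matrix.of fun k i => fderiv ℝ (fun p' => φ i p' k) p v) := by
    intro v p k i
    exact ⟨((hφsmooth i k).differentiable (by simp)) p, rfl⟩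
  have hMd : ∀ v p (Yd : Matrix (Fin 2) (Fin N) ℂ), HD v p Y Yd → HD v p M
      (Matrix.of fun i j => (Ydᴴ * Y p + (Y p)ᴴ * Yd) i j / ((starRingEnd ℂ) (lam i) - lam j)) := by
    intro v p Yd h i j
    have h1 := (h.conjT.mul h) i j
    have e : (fun p' => M p' i j) = fun p' => ((Y p')ᴴ * Y p') i j *
        ((starRingEnd ℂ) (lam i) - lam j)⁻¹ := by
      funext p'
      rw [hMdef, div_eq_mul_inv]
    have h2 := h1.1.hasFDerivAt.mul_const ((starRingEnd ℂ) (lam i) - lam j)⁻¹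
    rw [e]
    refine ⟨h2.differentiableAt, ?_⟩
    rw [h2.fderiv, Matrix.of_apply, ContinuousLinearMap.smul_apply, h1.2, smul_eq_mul, mul_comm,
      div_eq_mul_inv]
  have hPd : ∀ v p (Yd : Matrix (Fin 2) (Fin N) ℂ) (Md C : Matrix (Fin N) (Fin N) ℂ),
      HD v p Y Yd → HD v p M Md → HD v p (fun p => Y p * (M p)⁻¹ * C * (Y p)ᴴ)
        (Yd * (M p)⁻¹ * C * (Y p)ᴴ + Y p * (-((M p)⁻¹ * Md * (M p)⁻¹)) * C * (Y p)ᴴ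
          + Y p * (M p)⁻¹ * C * Ydᴴ) := by
    intro v p Yd Md C h h'
    have := ((h.mul (h'.inv hMinv)).mul (HD.const C)).mul h.conjT
    simpa only [Matrix.mul_zero, add_zero, Matrix.add_mul] using this
  have hsH : sigma3ᴴ = sigma3 := by
    ext i j
    fin_cases i <;> fin_cases j <;> simp [sigma3]
  have hQH : ∀ p, (Qmat q p)ᴴ = Qmat q p := by
    intro p
    ext i j
    fin_cases i <;> fin_cases j <;> simp [Qmat]
  have hYa : ∀ p k i, Y p k i = φ i p k := fun _ _ _ => rfl
  -- derivative of `S`-type expressions in `x`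
  have hPx : ∀ p (C : Matrix (Fin N) (Fin N) ℂ), C * Ls = Ls * C →
      HD (1, 0) p (fun p => Y p * (M p)⁻¹ * C * (Y p)ᴴ)
      (I • (sigma3 * (Y p * (M p)⁻¹ * (C * Ls) * (Y p)ᴴ)
        - sigma3 * (Y p * (M p)⁻¹ * (Y p)ᴴ) * (Y p * (M p)⁻¹ * C * (Y p)ᴴ)
        + Qmat q p * (Y p * (M p)⁻¹ * C * (Y p)ᴴ)
        + (Y p * (M p)⁻¹ * (Y p)ᴴ) * sigma3 * (Y p * (M p)⁻¹ * C * (Y p)ᴴ)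
        - (Y p * (M p)⁻¹ * (C * Ls) * (Y p)ᴴ) * sigma3
        - (Y p * (M p)⁻¹ * C * (Y p)ᴴ) * Qmat q p)) := by
    intro p C hC
    have hY1 : HD (1, 0) p Y (I • (sigma3 * Y p * L + Qmat q p * Y p)) := by
      convert hYd (1, 0) p using 1
      ext k i
      have := hφx i p k
      rw [pdx] at this
      rw [Matrix.of_apply, this]
      simp only [hL, Matrix.mul_diagonal, Matrix.smul_apply, Matrix.add_apply]
      simp only [Umat, Matrix.mul_apply, Matrix.mulVec, dotProduct, Fin.sum_univ_two, hYa,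
        Matrix.smul_apply, Matrix.add_apply]
      fin_cases k <;> simp [sigma3, Qmat] <;> ring
    have hY2 : (I • (sigma3 * Y p * L + Qmat q p * Y p))ᴴ
        = -(I • (Ls * (Y p)ᴴ * sigma3 + (Y p)ᴴ * Qmat q p)) := by
      simp [Matrix.conjTranspose_smul, Matrix.conjTranspose_mul, hLH, hsH, hQH, Matrix.mul_assoc]
      abel
    have hM1 : HD (1, 0) p M (-(I • ((Y p)ᴴ * sigma3 * Y p))) := by
      convert hMd (1, 0) p _ hY1 using 1
      rw [hY2]
      ext i j
      have e : -(I • (Ls * (Y p)ᴴ * sigma3 + (Y p)ᴴ * Qmat q p)) * Y p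
          + (Y p)ᴴ * (I • (sigma3 * Y p * L + Qmat q p * Y p))
          = -(I • (Ls * ((Y p)ᴴ * sigma3 * Y p) - ((Y p)ᴴ * sigma3 * Y p) * L)) := by
        simp only [Matrix.mul_add, Matrix.add_mul, Matrix.neg_mul, Matrix.smul_mul,
          Matrix.mul_smul, Matrix.mul_assoc, smul_add, smul_sub]
        abel
      rw [e, Matrix.of_apply]
      simp only [Matrix.neg_apply, Matrix.smul_apply, Matrix.sub_apply, hLs, hL,
        Matrix.diagonal_mul, Matrix.mul_diagonal, smul_eq_mul]
      rw [eq_div_iff (hsub i j)]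
      ring
    have h := hPd (1, 0) p _ _ C hY1 hM1
    rwa [alg_x _ _ _ L Ls C _ _ _ sigma3 (Qmat q p) rfl hY2 rfl (hLK p) hC] at h
  have hSS : ∀ p, S p = Y p * (M p)⁻¹ * (Y p)ᴴ := by
    intro p
    simp only [hS, Matrix.mul_one]
  have hPP1 : ∀ p, Y p * (M p)⁻¹ * (R * Ls) * (Y p)ᴴ = lam' • P p - S p := by
    intro p
    rw [hRL, hSS]
    simp only [hP, Matrix.mul_sub, Matrix.sub_mul, Matrix.mul_smul, Matrix.smul_mul, Matrix.mul_one]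
  have final : ∀ v p (A A1 : Matrix (Fin 2) (Fin 2) ℂ), HD v p P (A1 * (1 + P p) - (1 + P p) * A) →
      HD v p Φ (A * Φ p) → ∀ k l, fderiv ℝ (fun p' => (T p' * Φ p') k l) p v
        = (A1 * (T p * Φ p)) k l := by
    intro v p A A1 h h' k l
    have hT1 : T = fun p => 1 + P p := funext hTP
    have := (((HD.const 1).add h).mul h') k l
    rw [hT1]
    refine this.2.trans ?_
    refine congrFun (congrFun ?_ k) l
    simp only [Matrix.mul_add, Matrix.add_mul, Matrix.sub_mul, Matrix.mul_assoc, Matrix.one_mul,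
      Matrix.mul_one, zero_add]
    abel
  have hΦd : ∀ p k l, DifferentiableAt ℝ (fun p' => Φ p' k l) p :=
    fun p k l => ((hΦsmooth k l).differentiable (by simp)) p
  refine ⟨fun p => ?_, fun p => ?_⟩
  · refine final (1, 0) p (Umat q lam' p) (Umat qN lam' p) ?_ fun k l => ⟨hΦd p k l, hΦx p k l⟩
    have h := hPx p R hR
    rw [hPP1, ← hSS] at h
    have e := fin_x ((starRingEnd ℂ) (q p)) (q p) lam' (S p) (P p)
    have h2 : HD (1, 0) p P _ := h
    simp only [Umat, hQN]
    rw [show !![0, (starRingEnd ℂ) (q p); q p, 0] = Qmat q p from rfl] at e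
    rw [← e]
    exact h2
  · refine final (0, 1) p (Vmat q lam' p) (Vmat qN lam' p) ?_ fun k l => ⟨hΦd p k l, hΦt p k l⟩
    obtain ⟨Sx, hSx⟩ : ∃ Sx, Sx = I • (sigma3 * (Y p * (M p)⁻¹ * Ls * (Y p)ᴴ)
        - sigma3 * S p * S p + Qmat q p * S p + S p * sigma3 * S p
        - (Y p * (M p)⁻¹ * Ls * (Y p)ᴴ) * sigma3 - S p * Qmat q p) := ⟨_, rfl⟩
    have hSd : HD (1, 0) p S Sx := by
      have h := hPx p 1 (by simp)
      rw [hSx, funext hSS]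
      simpa only [Matrix.one_mul, Matrix.mul_one] using h
    have hQNx : Qmatx qN p = Qmatx q p + (Sx * sigma3 - sigma3 * Sx) := by
      have h := (hQd p).add ((hSd.mul (HD.const sigma3)).sub ((HD.const sigma3).mul hSd))
      have e : (fun p => Qmat q p + (S p * sigma3 - sigma3 * S p)) = Qmat qN :=
        (funext hQN).symm
      rw [e] at h
      simp only [Matrix.mul_zero, Matrix.zero_mul, add_zero, zero_add] at h
      ext i j
      exact (h i j).2
    obtain ⟨W, hW⟩ : ∃ W, W = -(I • (sigma3 * (Qmat q p * Qmat q p + I • Qmatx q p))) := ⟨_, rfl⟩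
    have hWH : Wᴴ = - W := by
      rw [hW, hQx]
      ext i j
      fin_cases i <;> fin_cases j <;>
        simp [sigma3, Qmat, Matrix.mul_apply, Fin.sum_univ_two] <;> ring
    have hV : ∀ l, Vmat q l p = (2 * I) • (l ^ 2 • sigma3 + l • Qmat q p) + W := by
      intro l
      rw [hW, Vmat]
      module
    have hY1 : HD (0, 1) p Y
        ((2 * I) • (sigma3 * Y p * L * L + Qmat q p * Y p * L) + W * Y p) := by
      convert hYd (0, 1) p using 1
      ext k i
      have := hφt i p k
      rw [pdt] at this
      rw [Matrix.of_apply, this, hV]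
      simp only [hL, Matrix.mul_diagonal, Matrix.smul_apply, Matrix.add_apply]
      simp only [Matrix.mul_apply, Matrix.mulVec, dotProduct, Fin.sum_univ_two, hYa,
        Matrix.smul_apply, Matrix.add_apply]
      fin_cases k <;> simp [sigma3, Qmat] <;> ring
    have hY2 : ((2 * I) • (sigma3 * Y p * L * L + Qmat q p * Y p * L) + W * Y p)ᴴ
        = -((2 * I) • (Ls * Ls * (Y p)ᴴ * sigma3 + Ls * (Y p)ᴴ * Qmat q p)) - (Y p)ᴴ * W := by
      simp [Matrix.conjTranspose_smul, Matrix.conjTranspose_mul, hLH, hsH, hQH, hWH,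
        Matrix.mul_assoc, sub_eq_add_neg]
      abel
    have hM1 : HD (0, 1) p M (-((2 * I) • (Ls * (Y p)ᴴ * sigma3 * Y p + (Y p)ᴴ * sigma3 * Y p * L
        + (Y p)ᴴ * Qmat q p * Y p))) := by
      convert hMd (0, 1) p _ hY1 using 1
      rw [hY2]
      ext i j
      have e : (-((2 * I) • (Ls * Ls * (Y p)ᴴ * sigma3 + Ls * (Y p)ᴴ * Qmat q p)) - (Y p)ᴴ * W)
            * Y p
          + (Y p)ᴴ * ((2 * I) • (sigma3 * Y p * L * L + Qmat q p * Y p * L) + W * Y p)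
          = -((2 * I) • (Ls * (Ls * ((Y p)ᴴ * sigma3 * Y p)) - ((Y p)ᴴ * sigma3 * Y p) * L * L
            + Ls * ((Y p)ᴴ * Qmat q p * Y p) - ((Y p)ᴴ * Qmat q p * Y p) * L)) := by
        simp only [Matrix.mul_add, Matrix.add_mul, Matrix.sub_mul, Matrix.neg_mul, Matrix.smul_mul,
          Matrix.mul_smul, Matrix.mul_assoc, smul_add, smul_sub]
        abel
      have e2 : Ls * (Y p)ᴴ * sigma3 * Y p = Ls * ((Y p)ᴴ * sigma3 * Y p) := by
        simp only [Matrix.mul_assoc]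
      rw [e, e2, Matrix.of_apply]
      simp only [Matrix.neg_apply, Matrix.smul_apply, Matrix.sub_apply, Matrix.add_apply, hLs, hL,
        Matrix.diagonal_mul, Matrix.mul_diagonal, smul_eq_mul]
      rw [eq_div_iff (hsub i j)]
      ring
    have hPP2 : lam' • (lam' • P p - S p) - Y p * (M p)⁻¹ * Ls * (Y p)ᴴ
        = Y p * (M p)⁻¹ * (R * Ls * Ls) * (Y p)ᴴ := by
      rw [← hPP1 p, hRL, Matrix.sub_mul, Matrix.smul_mul, hRL]
      simp only [Matrix.mul_sub, Matrix.sub_mul, Matrix.mul_smul, Matrix.smul_mul, Matrix.mul_one,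
        Matrix.one_mul]
    have h := hPd (0, 1) p _ _ R hY1 hM1
    rw [alg_t _ _ _ L Ls R _ _ _ sigma3 (Qmat q p) W rfl hY2 rfl (hLK p) hR (S p) _ (P p)
      (lam' • P p - S p) (lam' • (lam' • P p - S p) - Y p * (M p)⁻¹ * Ls * (Y p)ᴴ)
      (hSS p) rfl rfl (hPP1 p).symm hPP2] at h
    have e := fin_t _ _ _ _ lam' sigma3 (Qmat q p) (Qmatx q p) (S p)
      (Y p * (M p)⁻¹ * Ls * (Y p)ᴴ) (P p) _ _ W (Qmat qN p) Sx rfl rfl (hQx p) rfl rfl hW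
      (hQN p) hSx
    rw [e] at h
    rw [Vmat, Vmat, hQNx]
    exact h
end

section
/- For every integer N ≥ 1 and every choice of complex parameters κ₁, κ₂, …, the Adler–Moser polynomial Θ_N(z) = c_N·det_{1≤i,j≤N}(θ_{2i−j}(z)) is a monic polynomial in z of degree N(N+1)/2. -/
open Finset Polynomial

noncomputable section

/-- Schur-type elements `S_k(x)` of a commutative `ℂ`-algebra, defined by the generating
identity `∑_{k≥0} S_k(x) ε^k = exp (∑_{j≥1} x_j ε^j)`; equivalently (char 0) by `S_0 = 1`
and the recursion `(k+1)·S_{k+1} = ∑_{j=1}^{k+1} j·x_j·S_{k+1-j}`. -/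
def schurA {R : Type*} [CommRing R] [Algebra ℂ R] (x : ℕ → R) : ℕ → R
  | 0 => 1
  | k + 1 => ((k : ℂ) + 1)⁻¹ •
      ∑ i ∈ Finset.range (k + 1), ((i + 1 : ℕ) : R) * x (i + 1) * schurA x (k - i)
  termination_by k => k
  decreasing_by omega

/-- The polynomials `θ_k(z)` with parameters `κ`, defined by
`∑_{k≥0} θ_k(z) ε^k = exp(zε + ∑_{j≥1} κ_j ε^{2j+1})`, as elements of `ℂ[z]`. -/
def thetaPoly (κ : ℕ → ℂ) : ℕ → Polynomial ℂ :=
  schurA fun m => if m = 1 then Polynomial.X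
    else if m % 2 = 1 then Polynomial.C (κ ((m - 1) / 2)) else 0

/-- The Adler–Moser polynomial `Θ_N = c_N · det_{1≤i,j≤N}(θ_{2i-j})`,
`c_N = ∏_{k=1}^N (2k-1)!!`, as an element of `ℂ[z]`. -/
def AMPoly (κ : ℕ → ℂ) (N : ℕ) : Polynomial ℂ :=
  Polynomial.C (∏ k ∈ Finset.range N, ((2 * k + 1).doubleFactorial : ℂ)) *
    Matrix.det (Matrix.of fun i j : Fin N =>
      if (j : ℕ) + 1 ≤ 2 * ((i : ℕ) + 1) then thetaPoly κ (2 * ((i : ℕ) + 1) - ((j : ℕ) + 1))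
      else 0)

end


theorem am_theta_aux (κ : ℕ → ℂ) (k : ℕ) :
    (thetaPoly κ k).natDegree ≤ k ∧ (thetaPoly κ k).coeff k = ((k.factorial : ℂ))⁻¹ := by
  induction k using Nat.strong_induction_on with
  | _ k ih =>
    rcases k with _ | k
    · simp [thetaPoly, schurA]
    · have hrec : thetaPoly κ (k + 1) = ((k : ℂ) + 1)⁻¹ • (X * thetaPoly κ k +
          ∑ i ∈ Finset.range k, C (((i + 2 : ℕ) : ℂ) *
            (if i % 2 = 1 then κ ((i + 1) / 2) else 0)) * thetaPoly κ (k - (i + 1))) := by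
        rw [thetaPoly, schurA, Finset.sum_range_succ']
        refine congrArg _ ((add_comm _ _).trans ?_)
        congr 1
        · simp
        · refine Finset.sum_congr rfl fun i _ => ?_
          congr 1
          have h1 : ¬ (i + 1 + 1 = 1) := by omega
          have h2 : ((i + 1 + 1) % 2 = 1) ↔ i % 2 = 1 := by omega
          simp only [h1, h2, if_false]
          split_ifs
          · rw [C_mul, C_eq_natCast]
            rfl
          · simp
      have hs : (∑ i ∈ Finset.range k, C (((i + 2 : ℕ) : ℂ) *
            (if i % 2 = 1 then κ ((i + 1) / 2) else 0)) *
              thetaPoly κ (k - (i + 1))).natDegree ≤ k := by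
        refine natDegree_sum_le_of_forall_le _ _ fun i hi => ?_
        refine (natDegree_C_mul_le _ _).trans ?_
        exact (ih (k - (i + 1)) (by omega)).1.trans (by omega)
      obtain ⟨h1, h2⟩ := ih k (by omega)
      rw [hrec]
      constructor
      · refine (natDegree_smul_le _ _).trans (natDegree_add_le_of_degree_le ?_ (hs.trans (by omega)))
        refine natDegree_mul_le.trans ?_
        rw [natDegree_X]; omega
      · rw [coeff_smul, coeff_add, coeff_X_mul, h2,
          coeff_eq_zero_of_natDegree_lt (lt_of_le_of_lt hs (Nat.lt_succ_self k)), Nat.factorial_succ]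
        push_cast
        rw [add_zero, smul_eq_mul, mul_inv]

theorem am_prod_aux {ι : Type*} (s : Finset ι) (f : ι → ℂ[X]) (d : ι → ℕ)
    (h : ∀ i ∈ s, (f i).natDegree ≤ d i) :
    (∏ i ∈ s, f i).natDegree ≤ ∑ i ∈ s, d i ∧
      (∏ i ∈ s, f i).coeff (∑ i ∈ s, d i) = ∏ i ∈ s, (f i).coeff (d i) := by
  classical
  induction s using Finset.induction_on with
  | empty => simp
  | insert a s ha ih =>
    obtain ⟨h1, h2⟩ := ih fun i hi => h i (Finset.mem_insert_of_mem hi)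
    have h3 := h a (Finset.mem_insert_self _ _)
    rw [Finset.prod_insert ha, Finset.sum_insert ha, Finset.prod_insert ha,
      coeff_mul_add_eq_of_natDegree_le h3 h1, h2]
    exact ⟨natDegree_mul_le.trans (add_le_add h3 h1), rfl⟩

theorem am_sum_aux (N : ℕ) (σ : Equiv.Perm (Fin N))
    (h : ∀ i, ((i : Fin N) : ℕ) + 1 ≤ 2 * ((σ i : ℕ) + 1)) :
    ∑ i, (2 * ((σ i : ℕ) + 1) - ((i : ℕ) + 1)) = N * (N + 1) / 2 := by
  have h1 : ∑ i, (2 * ((σ i : ℕ) + 1) - ((i : ℕ) + 1)) + ∑ i : Fin N, ((i : ℕ) + 1)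
      = 2 * ∑ i : Fin N, ((i : ℕ) + 1) := by
    rw [← Finset.sum_add_distrib, ← Equiv.sum_comp σ (fun i : Fin N => ((i : ℕ) + 1)),
      Finset.mul_sum]
    rw [Equiv.sum_comp σ (fun i : Fin N => 2 * ((i : ℕ) + 1)),
      ← Equiv.sum_comp σ (fun i : Fin N => 2 * ((i : ℕ) + 1))]
    exact Finset.sum_congr rfl fun i _ => Nat.sub_add_cancel (h i)
  have h2 : ∑ i : Fin N, ((i : ℕ) + 1) = N * (N + 1) / 2 := by
    rw [Fin.sum_univ_eq_sum_range (fun i => i + 1) N]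
    have := Finset.sum_range_succ' (fun i => i) N
    rw [add_zero] at this
    rw [← this, Finset.sum_range_id]
    simp [mul_comm]
  omega

theorem am_det_const (N : ℕ) :
    (∏ k ∈ Finset.range N, ((2 * k + 1).doubleFactorial : ℂ)) *
      Matrix.det (Matrix.of fun i j : Fin N =>
      if (j : ℕ) + 1 ≤ 2 * ((i : ℕ) + 1) then
        (((2 * ((i : ℕ) + 1) - ((j : ℕ) + 1)).factorial : ℂ))⁻¹ else 0) = 1 := by
  rcases N with _ | n
  · simp
  set A : Matrix (Fin (n+1)) (Fin (n+1)) ℂ := Matrix.of fun i j : Fin (n+1) =>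
      if (j : ℕ) + 1 ≤ 2 * ((i : ℕ) + 1) then
        (((2 * ((i : ℕ) + 1) - ((j : ℕ) + 1)).factorial : ℂ))⁻¹ else 0 with hA
  have e1 := Matrix.det_mul_column (fun i : Fin (n+1) => ((2 * (i:ℕ) + 1).factorial : ℂ)) A
  have e2 : (Matrix.of fun i j : Fin (n+1) => ((2 * (i:ℕ) + 1).factorial : ℂ) * A i j) =
      Matrix.of (fun i j : Fin (n+1) =>
        (descPochhammer ℂ j).eval ((2 * (i:ℕ) + 1 : ℕ) : ℂ)) := by
    ext i j
    simp only [Matrix.of_apply, hA]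
    rw [descPochhammer_eval_eq_descFactorial]
    split_ifs with h
    · have hj : (j : ℕ) ≤ 2 * (i : ℕ) + 1 := by omega
      rw [← Nat.factorial_mul_descFactorial hj]
      have : 2 * ((i : ℕ) + 1) - ((j : ℕ) + 1) = 2 * (i : ℕ) + 1 - j := by omega
      rw [this]
      have := Nat.cast_ne_zero (R := ℂ) |>.2 (Nat.factorial_ne_zero (2 * (i : ℕ) + 1 - j))
      push_cast
      field_simp
    · rw [Nat.descFactorial_of_lt (by omega)]; simp
  rw [e2, ← Matrix.det_eval_matrixOfPolynomials_eq_det_vandermonde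
    (fun i : Fin (n+1) => ((2 * (i:ℕ) + 1 : ℕ) : ℂ)) (fun j => descPochhammer ℂ j)
    (fun i => descPochhammer_natDegree ℂ i) (fun i => monic_descPochhammer ℂ i)] at e1
  have e3 : (Matrix.vandermonde (fun i : Fin (n+1) => ((2 * (i:ℕ) + 1 : ℕ) : ℂ))).det =
      (∏ j : Fin (n+1), (2:ℂ) ^ (j:ℕ)) * n.superFactorial := by
    rw [← Matrix.det_vandermonde_id_eq_superFactorial, ← Matrix.det_mul_row]
    have := Matrix.det_vandermonde_add (fun i : Fin (n+1) => (2 * (i:ℕ) : ℂ)) 1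
    push_cast
    rw [this]
    congr 1
    ext i j
    simp [Matrix.vandermonde_apply, mul_pow]
  have e4 : (n.superFactorial : ℂ) = ∏ j : Fin (n+1), ((j:ℕ).factorial : ℂ) := by
    rw [← Nat.prod_range_succ_factorial, Fin.prod_univ_eq_prod_range (fun j => (j.factorial : ℂ))]
    push_cast; rfl
  have e5 : ∏ j : Fin (n+1), ((2 * (j:ℕ) + 1).factorial : ℂ) =
      (∏ k ∈ Finset.range (n+1), ((2 * k + 1).doubleFactorial : ℂ)) *
      ∏ j : Fin (n+1), ((2:ℂ) ^ (j:ℕ) * ((j:ℕ).factorial : ℂ)) := by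
    rw [← Fin.prod_univ_eq_prod_range (fun k => ((2 * k + 1).doubleFactorial : ℂ)),
      ← Finset.prod_mul_distrib]
    refine Finset.prod_congr rfl fun j _ => ?_
    rw [Nat.factorial_eq_mul_doubleFactorial, Nat.doubleFactorial_two_mul]
    push_cast; rfl
  rw [e3, e4, ← Finset.prod_mul_distrib, e5] at e1
  have hne : ∏ j : Fin (n+1), ((2:ℂ) ^ (j:ℕ) * ((j:ℕ).factorial : ℂ)) ≠ 0 :=
    Finset.prod_ne_zero_iff.2 fun j _ => mul_ne_zero (pow_ne_zero _ two_ne_zero)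
      (Nat.cast_ne_zero.2 (Nat.factorial_ne_zero _))
  apply mul_left_cancel₀ hne
  rw [mul_one]
  conv_rhs => rw [e1]
  ring

theorem am_det_aux (κ : ℕ → ℂ) (N : ℕ) (M : Matrix (Fin N) (Fin N) ℂ[X])
    (hM : M = Matrix.of fun i j : Fin N =>
      if (j : ℕ) + 1 ≤ 2 * ((i : ℕ) + 1) then thetaPoly κ (2 * ((i : ℕ) + 1) - ((j : ℕ) + 1))
      else 0) :
    M.det.natDegree ≤ N * (N + 1) / 2 ∧ M.det.coeff (N * (N + 1) / 2) =
      Matrix.det (Matrix.of fun i j : Fin N =>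
      if (j : ℕ) + 1 ≤ 2 * ((i : ℕ) + 1) then
        (((2 * ((i : ℕ) + 1) - ((j : ℕ) + 1)).factorial : ℂ))⁻¹ else 0) := by
  have key : ∀ σ : Equiv.Perm (Fin N), (∏ i, M (σ i) i).natDegree ≤ N * (N + 1) / 2 ∧
      (∏ i, M (σ i) i).coeff (N * (N + 1) / 2) = ∏ i : Fin N,
        (if (i : ℕ) + 1 ≤ 2 * ((σ i : ℕ) + 1) then
        (((2 * ((σ i : ℕ) + 1) - ((i : ℕ) + 1)).factorial : ℂ))⁻¹ else 0) := by
    intro σ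
    by_cases h : ∀ i, ((i : Fin N) : ℕ) + 1 ≤ 2 * ((σ i : ℕ) + 1)
    · have := am_prod_aux Finset.univ (fun i => M (σ i) i)
        (fun i => 2 * ((σ i : ℕ) + 1) - ((i : ℕ) + 1)) (fun i _ => by
          simp only [hM, Matrix.of_apply, if_pos (h i)]
          exact (am_theta_aux κ _).1)
      rw [am_sum_aux N σ h] at this
      refine ⟨this.1, this.2.trans (Finset.prod_congr rfl fun i _ => ?_)⟩
      simp only [hM, Matrix.of_apply, if_pos (h i)]
      exact (am_theta_aux κ _).2
    · push Not at h
      obtain ⟨i, hi⟩ := h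
      rw [Finset.prod_eq_zero (Finset.mem_univ i) (by simp only [hM, Matrix.of_apply]; rw [if_neg (by omega)]),
        Finset.prod_eq_zero (Finset.mem_univ i) (if_neg (by omega))]
      simp
  rw [Matrix.det_apply, Matrix.det_apply]
  constructor
  · refine natDegree_sum_le_of_forall_le _ _ fun σ _ => ?_
    exact (natDegree_smul_le _ _).trans (key σ).1
  · rw [finsetSum_coeff]
    refine Finset.sum_congr rfl fun σ _ => ?_
    rw [coeff_smul, (key σ).2]
    rfl

/-- **For every `N ≥ 1` and all parameters `κ`, the Adler–Moser polynomial `Θ_N` is a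
monic polynomial in `z` of degree `N(N+1)/2`.** -/
theorem AMPoly_monic_natDegree (N : ℕ) (hN : 1 ≤ N) (κ : ℕ → ℂ) :
    (AMPoly κ N).Monic ∧ (AMPoly κ N).natDegree = N * (N + 1) / 2 := by
  obtain ⟨h1, h2⟩ := am_det_aux κ N _ rfl
  have hc : (AMPoly κ N).coeff (N * (N + 1) / 2) = 1 := by
    rw [AMPoly, coeff_C_mul, h2, am_det_const]
  have hd : (AMPoly κ N).natDegree ≤ N * (N + 1) / 2 :=
    (natDegree_C_mul_le _ _).trans h1
  exact ⟨monic_of_natDegree_le_of_coeff_eq_one _ hd hc,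
    le_antisymm hd (le_natDegree_of_ne_zero (by rw [hc]; exact one_ne_zero))⟩
end
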